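/- arXiv:1804.08494 — 2 statements merged into one kernel-verified Lean document; each statement's English description precedes it below -/
import Mathlib

section
/- Let E be a metric space and B ⊆ E a set with int B ⊆ B ⊆ cl B. Let (yⁿ)ₙ∈ℕ be continuous paths from [0,∞) to E converging locally uniformly to a continuous path y, and assume that for the limit path the hitting times of the interior and of the closure of B coincide: s_{int B}(y) = s_{cl B}(y). Then the hitting times of B converge: lim_{n→∞} s_B(yⁿ) = s_B(y) in the extended half-line [0,∞]. -/
open Filter Topology
open scoped NNReal ENNReal

/-- Hitting time of a set `D` by a path `y : [0,∞) → E`, valued in `[0,∞]`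
(with `inf ∅ = ∞`). -/
noncomputable def hittingTime {E : Type*} [MetricSpace E] (y : ℝ≥0 → E) (D : Set E) : ℝ≥0∞ :=
  ⨅ s ∈ {s : ℝ≥0 | y s ∈ D}, (s : ℝ≥0∞)

theorem hittingTime_lt_iff {E : Type*} [MetricSpace E] {y : ℝ≥0 → E} {D : Set E} {a : ℝ≥0∞} :
    hittingTime y D < a ↔ ∃ s : ℝ≥0, y s ∈ D ∧ (s : ℝ≥0∞) < a := by
  simp [hittingTime, iInf_lt_iff]

theorem le_hittingTime_iff {E : Type*} [MetricSpace E] {y : ℝ≥0 → E} {D : Set E} {a : ℝ≥0∞} :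
    a ≤ hittingTime y D ↔ ∀ s : ℝ≥0, y s ∈ D → a ≤ s := by
  simp [hittingTime]

theorem hittingTime_anti {E : Type*} [MetricSpace E] (y : ℝ≥0 → E) {C D : Set E} (h : C ⊆ D) :
    hittingTime y D ≤ hittingTime y C :=
  biInf_mono fun _ hs => h hs

/-- The hitting time of an open set is upper semicontinuous along pointwise convergence. -/
theorem eventually_hittingTime_lt {E : Type*} [MetricSpace E] {U : Set E} (hU : IsOpen U)
    {ι : Type*} {l : Filter ι} {y : ι → ℝ≥0 → E} {ylim : ℝ≥0 → E}
    (hconv : ∀ s, Tendsto (fun n => y n s) l (𝓝 (ylim s))) {a : ℝ≥0∞}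
    (ha : hittingTime ylim U < a) : ∀ᶠ n in l, hittingTime (y n) U < a := by
  obtain ⟨s, hs, hsa⟩ := hittingTime_lt_iff.1 ha
  filter_upwards [hconv s (hU.mem_nhds hs)] with n hn
  exact hittingTime_lt_iff.2 ⟨s, hn, hsa⟩

/-- The hitting time of a closed set is lower semicontinuous along locally uniform convergence. -/
theorem eventually_lt_hittingTime {E : Type*} [MetricSpace E] {F : Set E} (hF : IsClosed F)
    {ι : Type*} {l : Filter ι} {y : ι → ℝ≥0 → E} {ylim : ℝ≥0 → E}
    (hy : ∀ n, Continuous (y n)) (hylim : Continuous ylim)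
    (hconv : TendstoLocallyUniformly y ylim l) {a : ℝ≥0∞}
    (ha : a < hittingTime ylim F) : ∀ᶠ n in l, a < hittingTime (y n) F := by
  obtain ⟨b, hab, hb⟩ := ENNReal.lt_iff_exists_nnreal_btwn.1 ha
  have hlim : Tendsto (fun n => (⟨y n, hy n⟩ : C(ℝ≥0, E))) l (𝓝 ⟨ylim, hylim⟩) :=
    ContinuousMap.tendsto_iff_tendstoLocallyUniformly.2 hconv
  have hmaps : Set.MapsTo (⟨ylim, hylim⟩ : C(ℝ≥0, E)) (Set.Icc 0 b) Fᶜ := fun s hs hsF =>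
    (hb.trans_le (le_hittingTime_iff.1 le_rfl s hsF)).not_ge (ENNReal.coe_le_coe.2 hs.2)
  filter_upwards [hlim (ContinuousMap.eventually_mapsTo isCompact_Icc hF.isOpen_compl hmaps)]
    with n hn
  refine hab.trans_le (le_hittingTime_iff.2 fun s hs => ?_)
  by_contra! hsb
  exact hn ⟨zero_le, (ENNReal.coe_lt_coe.1 hsb).le⟩ hs

/-- If the hitting times of the interior and the closure of `B` coincide for the
limit path, then the hitting times of `B` converge along a locally uniformly
converging sequence of continuous paths. -/
theorem tendsto_hittingTime {E : Type*} [MetricSpace E] (B : Set E)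
    (hB : interior B ⊆ B ∧ B ⊆ closure B)
    (y : ℕ → ℝ≥0 → E) (ylim : ℝ≥0 → E)
    (hy : ∀ n, Continuous (y n)) (hylim : Continuous ylim)
    (hconv : TendstoLocallyUniformly y ylim atTop)
    (heq : hittingTime ylim (interior B) = hittingTime ylim (closure B)) :
    Tendsto (fun n => hittingTime (y n) B) atTop (𝓝 (hittingTime ylim B)) := by
  refine tendsto_order.2 ⟨fun a ha => ?_, fun a ha => ?_⟩
  · have hcl : a < hittingTime ylim (closure B) :=
      heq ▸ ha.trans_le (hittingTime_anti ylim hB.1)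
    filter_upwards [eventually_lt_hittingTime isClosed_closure hy hylim hconv hcl] with n hn
    exact hn.trans_le (hittingTime_anti (y n) hB.2)
  · have hint : hittingTime ylim (interior B) < a :=
      heq ▸ (hittingTime_anti ylim hB.2).trans_lt ha
    filter_upwards [eventually_hittingTime_lt isOpen_interior
      (fun s => (tendstoLocallyUniformlyOn_univ.2 hconv).tendsto_at (Set.mem_univ s)) hint] with n hn
    exact (hittingTime_anti (y n) hB.1).trans_lt hn
end

section
/- Bounds on the asymptotic variance of the AMS probability estimator (abstract form). Let p ∈ (0,1]. Let P : ℝ → ℝ be continuously differentiable on [0,1], antitone (nonincreasing) on [0,1], with P(0) = 1 and P(1) = p. Let V : [0,1] → ℝ be an integrable function satisfying 0 ≤ V(t) ≤ (p/P(t))(1 − p/P(t)) for all t ∈ [0,1]. Define σ² := −p² log p − 2∫₀¹ V(t) · P(t) · P′(t) dt. Then −p² log p ≤ σ² ≤ p² log p + 2p(1 − p) ≤ 2p(1 − p). -/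
open MeasureTheory Set

/-- Bounds on the asymptotic variance of the AMS probability estimator
(abstract form).  Here `P t` plays the role of the level-crossing probability
`p_t` (nonincreasing, `P 0 = 1`, `P 1 = p`, with continuous derivative `P'` on
`[0,1]`), and `V t` of the committor variance under the conditional level
distribution, bounded by the Bernoulli bound. -/
theorem ams_variance_bounds (p : ℝ) (hp0 : 0 < p) (hp1 : p ≤ 1)
    (P P' V : ℝ → ℝ)
    (hP : ∀ t ∈ Icc (0 : ℝ) 1, HasDerivWithinAt P (P' t) (Icc (0 : ℝ) 1) t)
    (hP' : ContinuousOn P' (Icc (0 : ℝ) 1))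
    (hanti : AntitoneOn P (Icc (0 : ℝ) 1))
    (hP0 : P 0 = 1) (hP1 : P 1 = p)
    (hVint : IntervalIntegrable V volume 0 1)
    (hV : ∀ t ∈ Icc (0 : ℝ) 1, 0 ≤ V t ∧ V t ≤ (p / P t) * (1 - p / P t)) :
    -p ^ 2 * Real.log p ≤
        -p ^ 2 * Real.log p - 2 * ∫ t in (0 : ℝ)..1, V t * P t * P' t ∧
      (-p ^ 2 * Real.log p - 2 * ∫ t in (0 : ℝ)..1, V t * P t * P' t) ≤
        p ^ 2 * Real.log p + 2 * p * (1 - p) ∧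
      p ^ 2 * Real.log p + 2 * p * (1 - p) ≤ 2 * p * (1 - p) := by
  have hPmem : ∀ t ∈ Icc (0 : ℝ) 1, p ≤ P t := fun t ht =>
    hP1 ▸ hanti ht (right_mem_Icc.2 zero_le_one) ht.2
  have hPpos : ∀ t ∈ Icc (0 : ℝ) 1, 0 < P t := fun t ht => hp0.trans_le (hPmem t ht)
  have hP'np : ∀ t ∈ Icc (0 : ℝ) 1, P' t ≤ 0 := fun t ht => by
    rw [← (hP t ht).derivWithin (uniqueDiffOn_Icc zero_lt_one t ht)]
    exact hanti.derivWithin_nonpos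
  have hPc : ContinuousOn P (Icc (0 : ℝ) 1) := fun t ht => (hP t ht).continuousWithinAt
  have hlog : Real.log p ≤ 0 := Real.log_nonpos hp0.le hp1
  have hplog : p ^ 2 * Real.log p ≤ 0 := mul_nonpos_of_nonneg_of_nonpos (sq_nonneg p) hlog
  have huIcc : uIcc (0 : ℝ) 1 = Icc 0 1 := uIcc_of_le zero_le_one
  have hint : IntervalIntegrable (fun t => V t * P t * P' t) volume 0 1 :=
    (hVint.mul_continuousOn (huIcc ▸ hPc)).mul_continuousOn (huIcc ▸ hP')
  have hbound_cont : ContinuousOn (fun t => p * P' t - p ^ 2 * (P' t / P t)) (Icc (0 : ℝ) 1) :=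
    (continuousOn_const.mul hP').sub
      (continuousOn_const.mul (hP'.div hPc fun t ht => (hPpos t ht).ne'))
  have hbound_int : IntervalIntegrable (fun t => p * P' t - p ^ 2 * (P' t / P t)) volume 0 1 :=
    ContinuousOn.intervalIntegrable (huIcc ▸ hbound_cont)
  have hFTC : ∫ t in (0 : ℝ)..1, (p * P' t - p ^ 2 * (P' t / P t)) =
      (p * P 1 - p ^ 2 * Real.log (P 1)) - (p * P 0 - p ^ 2 * Real.log (P 0)) := by
    refine intervalIntegral.integral_eq_sub_of_hasDerivAt_of_le
      (f := fun t => p * P t - p ^ 2 * Real.log (P t)) zero_le_one ?_ ?_ hbound_int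
    · exact (continuousOn_const.mul hPc).sub
        (continuousOn_const.mul (hPc.log fun t ht => (hPpos t ht).ne'))
    · intro t ht
      have ht' := Ioo_subset_Icc_self ht
      have hd : HasDerivAt P (P' t) t := (hP t ht').hasDerivAt (Icc_mem_nhds ht.1 ht.2)
      exact (hd.const_mul p).sub ((hd.log (hPpos t ht').ne').const_mul (p ^ 2))
  have hupper : ∫ t in (0 : ℝ)..1, V t * P t * P' t ≤ 0 := by
    have h := intervalIntegral.integral_mono_on (g := fun _ => (0 : ℝ)) zero_le_one hint
      intervalIntegrable_const fun t ht =>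
        mul_nonpos_of_nonneg_of_nonpos (mul_nonneg (hV t ht).1 (hPpos t ht).le) (hP'np t ht)
    simpa using h
  have hlower : ∫ t in (0 : ℝ)..1, (p * P' t - p ^ 2 * (P' t / P t)) ≤
      ∫ t in (0 : ℝ)..1, V t * P t * P' t := by
    refine intervalIntegral.integral_mono_on zero_le_one hbound_int hint fun t ht => ?_
    have hpos := hPpos t ht
    have heq : p * P' t - p ^ 2 * (P' t / P t) = p / P t * (1 - p / P t) * P t * P' t := by
      field_simp
    rw [heq]
    exact mul_le_mul_of_nonpos_right
      (mul_le_mul_of_nonneg_right (hV t ht).2 hpos.le) (hP'np t ht)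
  rw [hFTC, hP0, hP1, Real.log_one] at hlower
  exact ⟨by linarith, by linarith, by linarith⟩
end
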